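/- Suppose p satisfies Y ⊥ A | (Z,C), and let D(z,c) = (p(z|a⋆,c) − p(z|a°,c))²·Σ_ā p(ā|c)/p(z|ā,c) − p(z|a⋆,c)/p(a⋆|c) − p(z|a°,c)/p(a°|c). If D(z,c) ≤ 0 for all z ∈ 𝒵 and c ∈ 𝒞, then Var_p(φ_td) ≤ Var_p(φ_bd). If 𝒴 contains at least two elements and D(z,c) > 0 for all z ∈ 𝒵 and c ∈ 𝒞, then Var_p(φ_td) > Var_p(φ_bd). -/

import Mathlib

open Finset

noncomputable section

namespace TwoDoorPaper

/-- Indicator 1[a = b] as a real number. -/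
def ind {A : Type*} [DecidableEq A] (a b : A) : ℝ := if a = b then 1 else 0

variable {C A Z Y : Type*} [Fintype C] [Fintype A] [Fintype Z] [Fintype Y]

/-- Marginal p(c). -/
def pC (p : C → A → Z → Y → ℝ) (c : C) : ℝ := ∑ a, ∑ z, ∑ y, p c a z y

/-- Marginal p(a,c). -/
def pAC (p : C → A → Z → Y → ℝ) (a : A) (c : C) : ℝ := ∑ z, ∑ y, p c a z y

/-- Marginal p(c,a,z). -/
def pCAZ (p : C → A → Z → Y → ℝ) (c : C) (a : A) (z : Z) : ℝ := ∑ y, p c a z y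

/-- Marginal p(a). -/
def pA (p : C → A → Z → Y → ℝ) (a : A) : ℝ := ∑ c, pAC p a c

/-- Marginal p(a,z). -/
def pAZ (p : C → A → Z → Y → ℝ) (a : A) (z : Z) : ℝ := ∑ c, pCAZ p c a z

/-- Marginal p(z,c). -/
def pZC (p : C → A → Z → Y → ℝ) (z : Z) (c : C) : ℝ := ∑ a, pCAZ p c a z

/-- Conditional p(a|c). -/
def cA (p : C → A → Z → Y → ℝ) (a : A) (c : C) : ℝ := pAC p a c / pC p c

/-- Conditional p(z|a,c). -/
def cZ (p : C → A → Z → Y → ℝ) (z : Z) (a : A) (c : C) : ℝ := pCAZ p c a z / pAC p a c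

/-- Conditional p(z|a). -/
def cZA (p : C → A → Z → Y → ℝ) (z : Z) (a : A) : ℝ := pAZ p a z / pA p a

/-- Conditional p(y|a,z,c). -/
def cY (p : C → A → Z → Y → ℝ) (a : A) (z : Z) (c : C) (y : Y) : ℝ := p c a z y / pCAZ p c a z

/-- Conditional p(y|a,z). -/
def cYaz (p : C → A → Z → Y → ℝ) (a : A) (z : Z) (y : Y) : ℝ := (∑ c, p c a z y) / pAZ p a z

/-- Conditional p(y|a,c). -/
def cYac (p : C → A → Z → Y → ℝ) (a : A) (c : C) (y : Y) : ℝ := (∑ z, p c a z y) / pAC p a c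

/-- Conditional p(y|z,c). -/
def cYzc (p : C → A → Z → Y → ℝ) (z : Z) (c : C) (y : Y) : ℝ := (∑ a, p c a z y) / pZC p z c

/-- Conditional expectation E(Y|a,z,c). -/
def EYazc (p : C → A → Z → Y → ℝ) (yv : Y → ℝ) (a : A) (z : Z) (c : C) : ℝ :=
  ∑ y, yv y * cY p a z c y

/-- Conditional variance var(Y|a,z,c). -/
def VYazc (p : C → A → Z → Y → ℝ) (yv : Y → ℝ) (a : A) (z : Z) (c : C) : ℝ :=
  (∑ y, (yv y) ^ 2 * cY p a z c y) - (EYazc p yv a z c) ^ 2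

/-- Conditional expectation E(Y|a,z). -/
def EYaz (p : C → A → Z → Y → ℝ) (yv : Y → ℝ) (a : A) (z : Z) : ℝ :=
  ∑ y, yv y * cYaz p a z y

/-- Conditional variance var(Y|a,z). -/
def VYaz (p : C → A → Z → Y → ℝ) (yv : Y → ℝ) (a : A) (z : Z) : ℝ :=
  (∑ y, (yv y) ^ 2 * cYaz p a z y) - (EYaz p yv a z) ^ 2

/-- Conditional expectation E(Y|a,c). -/
def EYac (p : C → A → Z → Y → ℝ) (yv : Y → ℝ) (a : A) (c : C) : ℝ :=
  ∑ y, yv y * cYac p a c y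

/-- Conditional expectation E(Y|z,c). -/
def EYzc (p : C → A → Z → Y → ℝ) (yv : Y → ℝ) (z : Z) (c : C) : ℝ :=
  ∑ y, yv y * cYzc p z c y

/-- Conditional variance var(Y|z,c). -/
def VYzc (p : C → A → Z → Y → ℝ) (yv : Y → ℝ) (z : Z) (c : C) : ℝ :=
  (∑ y, (yv y) ^ 2 * cYzc p z c y) - (EYzc p yv z c) ^ 2

/-- var(C|a) for real-valued covariates. -/
def VCgivenA (p : C → A → Z → Y → ℝ) (cv : C → ℝ) (a : A) : ℝ :=
  (∑ c, (cv c) ^ 2 * (pAC p a c / pA p a)) - (∑ c, cv c * (pAC p a c / pA p a)) ^ 2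

/-- var(Z|a) for real-valued mediators. -/
def VZgivenA (p : C → A → Z → Y → ℝ) (zv : Z → ℝ) (a : A) : ℝ :=
  (∑ z, (zv z) ^ 2 * cZA p z a) - (∑ z, zv z * cZA p z a) ^ 2

/-- Expectation of f under p. -/
def Ep (p : C → A → Z → Y → ℝ) (f : C → A → Z → Y → ℝ) : ℝ :=
  ∑ c, ∑ a, ∑ z, ∑ y, p c a z y * f c a z y

/-- Variance of f under p. -/
def Varp (p : C → A → Z → Y → ℝ) (f : C → A → Z → Y → ℝ) : ℝ :=
  (∑ c, ∑ a, ∑ z, ∑ y, p c a z y * (f c a z y) ^ 2) - (Ep p f) ^ 2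

/-- p is a strictly positive probability mass function. -/
def IsPMF (p : C → A → Z → Y → ℝ) : Prop :=
  (∀ c a z y, 0 < p c a z y) ∧ (∑ c, ∑ a, ∑ z, ∑ y, p c a z y) = 1

/-- Y ⊥ A | (Z, C): p(y|a,z,c) does not depend on a. -/
def IndepYA (p : C → A → Z → Y → ℝ) : Prop :=
  ∀ a a' z c y, cY p a z c y = cY p a' z c y

/-- Z ⊥ C | A: p(z|a,c) = p(z|a) for all c. -/
def IndepZC (p : C → A → Z → Y → ℝ) : Prop :=
  ∀ z a c, cZ p z a c = cZA p z a

/-- θ_td. -/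
def thTD (p : C → A → Z → Y → ℝ) (yv : Y → ℝ) (astar acirc : A) : ℝ :=
  ∑ z, ∑ c, ∑ ab, EYazc p yv ab z c * (cZ p z astar c - cZ p z acirc c) * cA p ab c * pC p c

/-- The two-door efficient influence function φ_td. -/
def phiTD [DecidableEq A] (p : C → A → Z → Y → ℝ) (yv : Y → ℝ) (astar acirc : A)
    (c : C) (a : A) (z : Z) (y : Y) : ℝ :=
  (yv y - EYazc p yv a z c) * (cZ p z astar c - cZ p z acirc c) / cZ p z a c
  + ((∑ ab, EYazc p yv ab z c * cA p ab c)
      - ∑ ab, ∑ z', EYazc p yv ab z' c * cZ p z' a c * cA p ab c)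
    * (ind a astar - ind a acirc) / cA p a c
  + (∑ z', EYazc p yv a z' c * (cZ p z' astar c - cZ p z' acirc c))
  - thTD p yv astar acirc

/-- θ_bd. -/
def thBD (p : C → A → Z → Y → ℝ) (yv : Y → ℝ) (astar acirc : A) : ℝ :=
  ∑ c, pC p c * (EYac p yv astar c - EYac p yv acirc c)

/-- The back-door efficient influence function φ_bd. -/
def phiBD [DecidableEq A] (p : C → A → Z → Y → ℝ) (yv : Y → ℝ) (astar acirc : A)
    (c : C) (a : A) (_z : Z) (y : Y) : ℝ :=
  ind a astar * (yv y - EYac p yv astar c) / cA p astar c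
  - ind a acirc * (yv y - EYac p yv acirc c) / cA p acirc c
  + EYac p yv astar c - EYac p yv acirc c - thBD p yv astar acirc

/-- θ° (for the combined back-door/two-door model). -/
def thBDTD (p : C → A → Z → Y → ℝ) (yv : Y → ℝ) (astar acirc : A) : ℝ :=
  ∑ z, ∑ c, EYzc p yv z c * (cZ p z astar c - cZ p z acirc c) * pC p c

/-- The efficient influence function φ_bdtd. -/
def phiBDTD [DecidableEq A] (p : C → A → Z → Y → ℝ) (yv : Y → ℝ) (astar acirc : A)
    (c : C) (a : A) (z : Z) (y : Y) : ℝ :=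
  (yv y - EYzc p yv z c) * (cZ p z astar c - cZ p z acirc c) / (∑ ab, cZ p z ab c * cA p ab c)
  + (EYzc p yv z c - ∑ z', EYzc p yv z' c * cZ p z' a c)
    * (ind a astar - ind a acirc) / cA p a c
  + (∑ z', EYzc p yv z' c * (cZ p z' astar c - cZ p z' acirc c))
  - thBDTD p yv astar acirc

/-- ψ_fd(ă). -/
def psiFD (p : C → A → Z → Y → ℝ) (yv : Y → ℝ) (abreve : A) : ℝ :=
  ∑ z, ∑ ab, EYaz p yv ab z * pA p ab * cZA p z abreve

/-- θ_fd. -/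
def thFD (p : C → A → Z → Y → ℝ) (yv : Y → ℝ) (astar acirc : A) : ℝ :=
  psiFD p yv astar - psiFD p yv acirc

/-- The front-door efficient influence function φ_fd. -/
def phiFD [DecidableEq A] (p : C → A → Z → Y → ℝ) (yv : Y → ℝ) (astar acirc : A)
    (_c : C) (a : A) (z : Z) (y : Y) : ℝ :=
  (yv y - EYaz p yv a z) * (cZA p z astar - cZA p z acirc) / cZA p z a
  + ind a astar * ((∑ ab, EYaz p yv ab z * pA p ab) - psiFD p yv astar) / pA p astar
  - ind a acirc * ((∑ ab, EYaz p yv ab z * pA p ab) - psiFD p yv acirc) / pA p acirc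
  + (∑ z', EYaz p yv a z' * (cZA p z' astar - cZA p z' acirc))
  - thFD p yv astar acirc

/-- θ' (for the combined front-door/two-door model). -/
def thFDTD (p : C → A → Z → Y → ℝ) (yv : Y → ℝ) (astar acirc : A) : ℝ :=
  ∑ c, ∑ ab, ∑ z, EYazc p yv ab z c * (cZA p z astar - cZA p z acirc) * cA p ab c * pC p c

/-- The efficient influence function φ_fdtd. -/
def phiFDTD [DecidableEq A] (p : C → A → Z → Y → ℝ) (yv : Y → ℝ) (astar acirc : A)
    (c : C) (a : A) (z : Z) (y : Y) : ℝ :=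
  (yv y - EYazc p yv a z c) * (cZA p z astar - cZA p z acirc) / cZA p z a
  + (∑ c', ((∑ ab, EYazc p yv ab z c' * cA p ab c')
        - ∑ ab, ∑ z', EYazc p yv ab z' c' * cZA p z' a * cA p ab c') * pC p c')
    * (ind a astar - ind a acirc) / pA p a
  + (∑ z', EYazc p yv a z' c * (cZA p z' astar - cZA p z' acirc))
  - thFDTD p yv astar acirc

/-- θ'' (for the combined back/front/two-door model). -/
def thBDFDTD (p : C → A → Z → Y → ℝ) (yv : Y → ℝ) (astar acirc : A) : ℝ :=
  ∑ c, ∑ z, EYzc p yv z c * (cZA p z astar - cZA p z acirc) * pC p c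

/-- The efficient influence function φ_bdfdtd. -/
def phiBDFDTD [DecidableEq A] (p : C → A → Z → Y → ℝ) (yv : Y → ℝ) (astar acirc : A)
    (c : C) (a : A) (z : Z) (y : Y) : ℝ :=
  (yv y - EYzc p yv z c) * (cZA p z astar - cZA p z acirc) / (∑ ab, cA p ab c * cZA p z ab)
  + (∑ c', (EYzc p yv z c' - ∑ z', EYzc p yv z' c' * cZA p z' a) * pC p c')
    * (ind a astar - ind a acirc) / (∑ c', pC p c' * cA p a c')
  + (∑ z', EYzc p yv z' c * (cZA p z' astar - cZA p z' acirc))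
  - thBDFDTD p yv astar acirc

lemma pCAZ_pos [Nonempty Y] {p : C → A → Z → Y → ℝ} (hp : IsPMF p) (c : C) (a : A) (z : Z) :
    0 < pCAZ p c a z :=
  sum_pos (fun y _ => hp.1 c a z y) univ_nonempty

lemma pAC_pos [Nonempty Z] [Nonempty Y] {p : C → A → Z → Y → ℝ} (hp : IsPMF p) (a : A) (c : C) :
    0 < pAC p a c :=
  sum_pos (fun z _ => pCAZ_pos hp c a z) univ_nonempty

lemma pC_pos [Nonempty A] [Nonempty Z] [Nonempty Y] {p : C → A → Z → Y → ℝ} (hp : IsPMF p)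
    (c : C) : 0 < pC p c :=
  sum_pos (fun a _ => pAC_pos hp a c) univ_nonempty

lemma cA_pos [Nonempty A] [Nonempty Z] [Nonempty Y] {p : C → A → Z → Y → ℝ} (hp : IsPMF p)
    (a : A) (c : C) : 0 < cA p a c :=
  div_pos (pAC_pos hp a c) (pC_pos hp c)

lemma cZ_pos [Nonempty Z] [Nonempty Y] {p : C → A → Z → Y → ℝ} (hp : IsPMF p)
    (z : Z) (a : A) (c : C) : 0 < cZ p z a c :=
  div_pos (pCAZ_pos hp c a z) (pAC_pos hp a c)

lemma cY_pos [Nonempty Y] {p : C → A → Z → Y → ℝ} (hp : IsPMF p)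
    (a : A) (z : Z) (c : C) (y : Y) : 0 < cY p a z c y :=
  div_pos (hp.1 c a z y) (pCAZ_pos hp c a z)

lemma pCAZ_eq_mul [Nonempty A] [Nonempty Z] [Nonempty Y] {p : C → A → Z → Y → ℝ} (hp : IsPMF p)
    (c : C) (a : A) (z : Z) : pCAZ p c a z = pC p c * cA p a c * cZ p z a c := by
  have h₁ := (pAC_pos hp a c).ne'
  have h₂ := (pC_pos hp c).ne'
  unfold cA cZ
  field_simp

lemma eq_pCAZ_mul_cY [Nonempty Y] {p : C → A → Z → Y → ℝ} (hp : IsPMF p)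
    (c : C) (a : A) (z : Z) (y : Y) : p c a z y = pCAZ p c a z * cY p a z c y :=
  (mul_div_cancel₀ _ (pCAZ_pos hp c a z).ne').symm

lemma sum_cY [Nonempty Y] {p : C → A → Z → Y → ℝ} (hp : IsPMF p) (a : A) (z : Z) (c : C) :
    ∑ y, cY p a z c y = 1 := by
  unfold cY
  rw [← sum_div]
  exact div_self (pCAZ_pos hp c a z).ne'

lemma sum_cA [Nonempty A] [Nonempty Z] [Nonempty Y] {p : C → A → Z → Y → ℝ} (hp : IsPMF p)
    (c : C) : ∑ a, cA p a c = 1 := by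
  unfold cA
  rw [← sum_div]
  exact div_self (pC_pos hp c).ne'

lemma sum_sub_EYazc_mul [Nonempty Y] {p : C → A → Z → Y → ℝ} (hp : IsPMF p) (yv : Y → ℝ)
    (a : A) (z : Z) (c : C) : ∑ y, p c a z y * (yv y - EYazc p yv a z c) = 0 := by
  have h : ∀ y, p c a z y * (yv y - EYazc p yv a z c)
      = pCAZ p c a z * (yv y * cY p a z c y - EYazc p yv a z c * cY p a z c y) := fun y => by
    rw [eq_pCAZ_mul_cY hp c a z y]; ring
  simp_rw [h, ← mul_sum, sum_sub_distrib, ← mul_sum, sum_cY hp]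
  simp [EYazc]

/-- The law of total expectation for `E(Y|a,c)`. -/
lemma EYac_eq_sum [Nonempty Y] [Nonempty Z] {p : C → A → Z → Y → ℝ} (hp : IsPMF p) (yv : Y → ℝ)
    (a : A) (c : C) : EYac p yv a c = ∑ z, EYazc p yv a z c * cZ p z a c := by
  unfold EYac EYazc cYac
  simp_rw [sum_mul, sum_div, mul_sum]
  rw [sum_comm]
  refine sum_congr rfl fun z _ => sum_congr rfl fun y _ => ?_
  have := (pCAZ_pos hp c a z).ne'
  unfold cY cZ
  field_simp

omit [Fintype C] [Fintype A] [Fintype Z] in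
lemma EYazc_congr {p : C → A → Z → Y → ℝ} (hind : IndepYA p) (yv : Y → ℝ) (a b : A) (z : Z)
    (c : C) : EYazc p yv a z c = EYazc p yv b z c :=
  sum_congr rfl fun y _ => by rw [hind a b z c y]

/-- Two functions that differ only in the coefficient of a conditionally centred residual `e`
have variances that differ only through the second moment of that residual. -/
lemma Varp_sub_Varp {p f₁ f₂ : C → A → Z → Y → ℝ} {e : C → Z → Y → ℝ} {g₁ g₂ r : C → A → Z → ℝ}
    (he : ∀ c a z, ∑ y, p c a z y * e c z y = 0)
    (h₁ : ∀ c a z y, f₁ c a z y = e c z y * g₁ c a z + r c a z)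
    (h₂ : ∀ c a z y, f₂ c a z y = e c z y * g₂ c a z + r c a z) :
    Varp p f₁ - Varp p f₂
      = ∑ c, ∑ a, ∑ z, (∑ y, p c a z y * e c z y ^ 2) * (g₁ c a z ^ 2 - g₂ c a z ^ 2) := by
  have hE : Ep p f₁ = Ep p f₂ := by
    refine sum_congr rfl fun c _ => sum_congr rfl fun a _ => sum_congr rfl fun z _ => ?_
    rw [← sub_eq_zero, ← sum_sub_distrib]
    have h : ∀ y, p c a z y * f₁ c a z y - p c a z y * f₂ c a z y
        = p c a z y * e c z y * (g₁ c a z - g₂ c a z) := fun y => by rw [h₁, h₂]; ring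
    simp_rw [h, ← sum_mul, he, zero_mul]
  unfold Varp
  rw [hE, sub_sub_sub_cancel_right]
  simp_rw [← sum_sub_distrib]
  refine sum_congr rfl fun c _ => sum_congr rfl fun a _ => sum_congr rfl fun z _ => ?_
  have h : ∀ y, p c a z y * f₁ c a z y ^ 2 - p c a z y * f₂ c a z y ^ 2
      = p c a z y * e c z y ^ 2 * (g₁ c a z ^ 2 - g₂ c a z ^ 2)
        + p c a z y * e c z y * (2 * r c a z * (g₁ c a z - g₂ c a z)) := fun y => by
    rw [h₁, h₂]; ring
  simp_rw [h, sum_add_distrib, ← sum_mul, he, zero_mul, add_zero]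

lemma sum_mul_sq_sub_sq [DecidableEq A] {α ζ : A → ℝ} (hα : ∀ a, 0 < α a) (hζ : ∀ a, 0 < ζ a)
    {a₁ a₂ : A} (hne : a₁ ≠ a₂) (δ : ℝ) :
    ∑ a, α a * ζ a * ((δ / ζ a) ^ 2 - ((ind a a₁ - ind a a₂) / α a) ^ 2)
      = δ ^ 2 * (∑ a, α a / ζ a) - ζ a₁ / α a₁ - ζ a₂ / α a₂ := by
  have h : ∀ a, α a * ζ a * ((δ / ζ a) ^ 2 - ((ind a a₁ - ind a a₂) / α a) ^ 2)
      = δ ^ 2 * (α a / ζ a) - (if a = a₁ then ζ a / α a else 0)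
        - (if a = a₂ then ζ a / α a else 0) := fun a => by
    have := (hα a).ne'
    have := (hζ a).ne'
    unfold ind
    by_cases h₁ : a = a₁
    · have h₂ : a ≠ a₂ := h₁ ▸ hne
      simp only [if_pos h₁, if_neg h₂]
      field_simp
      ring
    · by_cases h₂ : a = a₂
      · simp only [if_neg h₁, if_pos h₂]
        field_simp
        ring
      · simp only [if_neg h₁, if_neg h₂]
        field_simp
        ring
  simp_rw [h, sum_sub_distrib, ← mul_sum]
  simp

/-- Under `Y ⊥ A | (Z, C)` the two-door and back-door functionals coincide. -/
lemma thTD_eq_thBD [Nonempty A] [Nonempty Z] [Nonempty Y] {p : C → A → Z → Y → ℝ} (hp : IsPMF p)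
    (hind : IndepYA p) (yv : Y → ℝ) (astar acirc : A) :
    thTD p yv astar acirc = thBD p yv astar acirc := by
  unfold thTD thBD
  rw [sum_comm]
  refine sum_congr rfl fun c _ => ?_
  rw [EYac_eq_sum hp, EYac_eq_sum hp, ← sum_sub_distrib, mul_sum]
  refine sum_congr rfl fun z _ => ?_
  simp_rw [fun a => EYazc_congr hind yv a astar z c]
  rw [← sum_mul, ← mul_sum, sum_cA hp]
  ring

/-- The part of both influence functions that does not involve the outcome. -/
def commonPart [DecidableEq A] (p : C → A → Z → Y → ℝ) (yv : Y → ℝ) (astar acirc : A)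
    (c : C) (a : A) (z : Z) : ℝ :=
  (EYazc p yv astar z c - EYac p yv a c) * ((ind a astar - ind a acirc) / cA p a c)
    + (EYac p yv astar c - EYac p yv acirc c) - thBD p yv astar acirc

lemma phiTD_eq [DecidableEq A] [Nonempty A] [Nonempty Z] [Nonempty Y]
    {p : C → A → Z → Y → ℝ} (hp : IsPMF p) (hind : IndepYA p) (yv : Y → ℝ) (astar acirc : A)
    (c : C) (a : A) (z : Z) (y : Y) :
    phiTD p yv astar acirc c a z y
      = (yv y - EYazc p yv astar z c) * ((cZ p z astar c - cZ p z acirc c) / cZ p z a c)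
        + commonPart p yv astar acirc c a z := by
  have h : ∀ a' z', EYazc p yv a' z' c = EYazc p yv astar z' c := fun a' z' =>
    EYazc_congr hind yv a' astar z' c
  unfold phiTD commonPart
  rw [thTD_eq_thBD hp hind]
  simp_rw [EYac_eq_sum hp, h, ← sum_mul, ← mul_sum, sum_cA hp, mul_sub, sum_sub_distrib]
  ring

lemma phiBD_eq [DecidableEq A] (p : C → A → Z → Y → ℝ) (yv : Y → ℝ) (astar acirc : A)
    (c : C) (a : A) (z : Z) (y : Y) :
    phiBD p yv astar acirc c a z y
      = (yv y - EYazc p yv astar z c) * ((ind a astar - ind a acirc) / cA p a c)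
        + commonPart p yv astar acirc c a z := by
  have h : ∀ b, ind a b * (yv y - EYac p yv b c) / cA p b c
      = ind a b * (yv y - EYac p yv a c) / cA p a c := fun b => by
    unfold ind
    split_ifs with hab
    · rw [hab]
    · simp
  unfold phiBD commonPart
  rw [h astar, h acirc]
  ring

/-- The gap between the two variances is a weighted sum of the discrepancies `D(z,c)`. -/
lemma Varp_phiTD_sub_Varp_phiBD [DecidableEq A] [Nonempty A] [Nonempty Z] [Nonempty Y]
    {p : C → A → Z → Y → ℝ} (hp : IsPMF p) (hind : IndepYA p) (yv : Y → ℝ) {astar acirc : A}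
    (hne : astar ≠ acirc) :
    Varp p (phiTD p yv astar acirc) - Varp p (phiBD p yv astar acirc)
      = ∑ c, ∑ z, pC p c * (∑ y, cY p astar z c y * (yv y - EYazc p yv astar z c) ^ 2)
        * ((cZ p z astar c - cZ p z acirc c) ^ 2 * (∑ ab, cA p ab c / cZ p z ab c)
          - cZ p z astar c / cA p astar c - cZ p z acirc c / cA p acirc c) := by
  rw [Varp_sub_Varp (e := fun c z y => yv y - EYazc p yv astar z c) (fun c a z => ?_)
    (phiTD_eq hp hind yv astar acirc) (phiBD_eq p yv astar acirc)]
  · refine sum_congr rfl fun c _ => ?_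
    rw [sum_comm]
    refine sum_congr rfl fun z _ => ?_
    rw [← sum_mul_sq_sub_sq (fun a => cA_pos hp a c) (fun a => cZ_pos hp z a c) hne, mul_sum]
    refine sum_congr rfl fun a _ => ?_
    have h : ∑ y, p c a z y * (yv y - EYazc p yv astar z c) ^ 2
        = pCAZ p c a z * ∑ y, cY p astar z c y * (yv y - EYazc p yv astar z c) ^ 2 := by
      rw [mul_sum]
      refine sum_congr rfl fun y _ => ?_
      rw [eq_pCAZ_mul_cY hp c a z y, hind a astar z c y, mul_assoc]
    rw [h, pCAZ_eq_mul hp]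
    ring
  · rw [EYazc_congr hind yv astar a z c]
    exact sum_sub_EYazc_mul hp yv a z c

/-- Proposition 2 (sufficient conditions comparing the two-door and back-door bounds). -/
theorem stmt2
    {C A Z Y : Type*} [Fintype C] [Fintype A] [Fintype Z] [Fintype Y]
    [Nonempty C] [Nonempty A] [Nonempty Z] [Nonempty Y] [DecidableEq A]
    (p : C → A → Z → Y → ℝ) (yv : Y → ℝ) (hyv : Function.Injective yv)
    (hp : IsPMF p) (astar acirc : A) (hne : astar ≠ acirc)
    (hind : IndepYA p) :
    ((∀ z c, (cZ p z astar c - cZ p z acirc c) ^ 2 * (∑ ab, cA p ab c / cZ p z ab c)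
          - cZ p z astar c / cA p astar c - cZ p z acirc c / cA p acirc c ≤ 0) →
        Varp p (phiTD p yv astar acirc) ≤ Varp p (phiBD p yv astar acirc))
      ∧ ((∃ y1 y2 : Y, y1 ≠ y2) →
        (∀ z c, 0 < (cZ p z astar c - cZ p z acirc c) ^ 2 * (∑ ab, cA p ab c / cZ p z ab c)
          - cZ p z astar c / cA p astar c - cZ p z acirc c / cA p acirc c) →
        Varp p (phiBD p yv astar acirc) < Varp p (phiTD p yv astar acirc)) := by
  have key := Varp_phiTD_sub_Varp_phiBD hp hind yv hne
  refine ⟨fun hD => ?_, fun ⟨y₁, y₂, hy⟩ hD => ?_⟩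
  · rw [← sub_nonpos, key]
    refine sum_nonpos fun c _ => sum_nonpos fun z _ => mul_nonpos_of_nonneg_of_nonpos ?_ (hD z c)
    exact mul_nonneg (pC_pos hp c).le
      (sum_nonneg fun y _ => mul_nonneg (cY_pos hp astar z c y).le (sq_nonneg _))
  · rw [← sub_pos, key]
    refine sum_pos (fun c _ => sum_pos (fun z _ => mul_pos (mul_pos (pC_pos hp c) ?_) (hD z c))
      univ_nonempty) univ_nonempty
    obtain ⟨y, hy⟩ : ∃ y, yv y ≠ EYazc p yv astar z c := by
      by_contra! h
      exact hy (hyv ((h y₁).trans (h y₂).symm))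
    exact sum_pos' (fun y _ => mul_nonneg (cY_pos hp astar z c y).le (sq_nonneg _))
      ⟨y, mem_univ y, mul_pos (cY_pos hp astar z c y) (sq_pos_of_ne_zero (sub_ne_zero.mpr hy))⟩

end TwoDoorPaper
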